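/- Let X be a set, let f, g : X → X, and let U be an ultrafilter on X. If f is injective, then Ultrafilter.map f U = Ultrafilter.map g U holds if and only if the equalizer {x ∈ X : f x = g x} belongs to U. -/

import Mathlib

theorem aux_T {X : Type*} (h : X → X) (U : Ultrafilter X)
    (hU : ∀ A : Set X, h ⁻¹' A ∈ U ↔ A ∈ U) (S T : Set X) (hS : S ∈ U)
    (hT : ∀ x ∈ S, (x ∈ T ↔ h x ∉ T)) : False := by
  by_cases hTU : T ∈ U
  · have h1 := (hU T).2 hTU
    obtain ⟨x, ⟨hx1, hx2⟩, hx3⟩ :=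
      U.nonempty_of_mem (Filter.inter_mem (Filter.inter_mem hTU h1) hS)
    exact (hT x hx3).1 hx1 hx2
  · have h1 : h ⁻¹' T ∉ U := fun h1 => hTU ((hU T).1 h1)
    obtain ⟨x, ⟨hx1, hx2⟩, hx3⟩ := U.nonempty_of_mem
      (Filter.inter_mem (Filter.inter_mem (Ultrafilter.compl_mem_iff_notMem.2 hTU)
        (Ultrafilter.compl_mem_iff_notMem.2 h1)) hS)
    exact hx1 ((hT x hx3).2 hx2)

theorem aux_per {X : Type*} (h : X → X) (x : X) (p d : ℕ) (hd : 0 < d)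
    (e : h^[p + d] x = h^[p] x) : ∀ N, ∃ n ≥ N, h^[n] x = h^[p] x := by
  have key : ∀ k, h^[p + k * d] x = h^[p] x := by
    intro k
    induction k with
    | zero => simp
    | succ k ih =>
      rw [show p + (k + 1) * d = k * d + (p + d) by ring, Function.iterate_add_apply, e,
        ← Function.iterate_add_apply, add_comm, ih]
  intro N
  exact ⟨p + N * d, by nlinarith, key N⟩

theorem aux_fix {X : Type*} (h : X → X) (U : Ultrafilter X)
    (hU : ∀ A : Set X, h ⁻¹' A ∈ U ↔ A ∈ U) : {x | h x = x} ∈ U := by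
  classical
  by_contra hfix
  have hnf := Ultrafilter.compl_mem_iff_notMem.2 hfix
  obtain ⟨x0, -⟩ := U.nonempty_of_mem hnf
  haveI : Nonempty X := ⟨x0⟩
  let F : X → X → Prop := fun x y => ∀ N, ∃ n ≥ N, h^[n] x = y
  have hF : ∀ x, F (h x) = F x := by
    intro x
    funext y
    apply propext
    constructor
    · intro H N
      obtain ⟨n, hn, e⟩ := H N
      exact ⟨n + 1, by omega, e⟩
    · intro H N
      obtain ⟨n, hn, e⟩ := H (N + 1)
      obtain ⟨k, rfl⟩ : ∃ k, n = k + 1 := ⟨n - 1, by omega⟩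
      exact ⟨k, by omega, e⟩
  by_cases hE : {x | ∃ y, F x y} ∈ U
  · let r : X → X := fun x => Classical.epsilon (F x)
    have hr : ∀ x, r (h x) = r x := fun x => by simp only [r, hF]
    by_cases hR : {x | x = r x} ∈ U
    · obtain ⟨x, ⟨hx1, hx2⟩, hx3⟩ := U.nonempty_of_mem
        (Filter.inter_mem (Filter.inter_mem hR ((hU _).2 hR)) hnf)
      simp only [Set.mem_preimage, Set.mem_setOf_eq, hr] at hx1 hx2
      exact hx3 (hx2.trans hx1.symm)
    · have hR' := Ultrafilter.compl_mem_iff_notMem.2 hR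
      let P : X → ℕ → Prop := fun x n => h^[n] x = r x
      have hreach : ∀ x, (∃ y, F x y) → ∃ n, P x n := by
        intro x hx
        obtain ⟨n, -, e⟩ := Classical.epsilon_spec hx 0
        exact ⟨n, e⟩
      refine aux_T h U hU _ {x | Even (sInf {n | P x n})} (Filter.inter_mem hE hR') ?_
      rintro x ⟨hx, hxr⟩
      have h0 : sInf {n | P x n} = sInf {n | P (h x) n} + 1 := by
        have hne : {n | P x n}.Nonempty := hreach x hx
        have hne' : {n | P (h x) n}.Nonempty := hreach (h x) (by rw [hF]; exact hx)
        have m1 : P x _ := Nat.sInf_mem hne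
        have m2 : P (h x) _ := Nat.sInf_mem hne'
        apply le_antisymm
        · apply Nat.sInf_le
          show h^[_ + 1] x = r x
          rw [← hr x]
          exact m2
        · rcases hk : sInf {n | P x n} with _ | k
          · rw [hk] at m1
            exact absurd m1 hxr
          · rw [hk] at m1
            have : sInf {n | P (h x) n} ≤ k := by
              apply Nat.sInf_le
              show h^[k] (h x) = r (h x)
              rw [hr x]
              exact m1
            omega
      simp only [Set.mem_setOf_eq, h0, Nat.even_add_one]
  · have hE' := Ultrafilter.compl_mem_iff_notMem.2 hE
    let G : X → X → Prop := fun x y => ∃ m n, h^[m] x = h^[n] y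
    have hG : ∀ x, G (h x) = G x := by
      intro x
      funext y
      apply propext
      constructor
      · rintro ⟨m, n, e⟩
        exact ⟨m + 1, n, e⟩
      · rintro ⟨m, n, e⟩
        refine ⟨m, n + 1, ?_⟩
        rw [← Function.iterate_succ_apply, Function.iterate_succ_apply', e,
          Function.iterate_succ_apply']
    let r : X → X := fun x => Classical.epsilon (G x)
    have hr : ∀ x, r (h x) = r x := fun x => by simp only [r, hG]
    have hGr : ∀ x, G x (r x) := fun x => Classical.epsilon_spec (p := G x) ⟨x, 0, 0, rfl⟩
    refine aux_T h U hU _ {x | ∃ m n, h^[m] x = h^[n] (r x) ∧ Even (m + n)} hE' ?_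
    intro x hx
    constructor
    · rintro ⟨m, n, e, ev⟩ ⟨m', n', e', ev'⟩
      rw [hr, ← Function.iterate_succ_apply] at e'
      apply hx
      have e1 : h^[n + (m' + 1)] (r x) = h^[n' + m] (r x) := by
        rw [add_comm n, add_comm n', Function.iterate_add_apply, ← e,
          Function.iterate_add_apply _ m n', ← e', ← Function.iterate_add_apply,
          ← Function.iterate_add_apply, add_comm]
      have hne : n + (m' + 1) ≠ n' + m := by
        intro q
        rw [Nat.even_iff] at ev ev'
        omega
      have gen : ∀ a b, a < b → h^[b] (r x) = h^[a] (r x) → ∃ y, F x y := by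
        intro a b hab q
        refine ⟨h^[m + a] x, aux_per h x (m + a) (b - a) (by omega) ?_⟩
        rw [show m + a + (b - a) = b + m by omega, add_comm m a,
          Function.iterate_add_apply, Function.iterate_add_apply, e,
          ← Function.iterate_add_apply, ← Function.iterate_add_apply, add_comm b, add_comm a,
          Function.iterate_add_apply, Function.iterate_add_apply, q]
      rcases lt_or_gt_of_ne hne with q | q
      · exact gen _ _ q e1.symm
      · exact gen _ _ q e1
    · intro hn
      by_contra hxT
      obtain ⟨m, n, e⟩ := hGr x
      apply hn
      refine ⟨m, n + 1, ?_, ?_⟩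
      · rw [hr, ← Function.iterate_succ_apply, Function.iterate_succ_apply', e,
          Function.iterate_succ_apply']
      · rw [← add_assoc, Nat.even_add_one]
        exact fun q => hxT ⟨m, n, e, q⟩

/-- If `f` is injective, then `Ultrafilter.map f U = Ultrafilter.map g U` iff the
equalizer `{x : f x = g x}` belongs to `U`. -/
theorem stmt14 {X : Type*} (f g : X → X) (U : Ultrafilter X)
    (hf : Function.Injective f) :
    Ultrafilter.map f U = Ultrafilter.map g U ↔ {x : X | f x = g x} ∈ U := by
  constructor
  · intro H
    have hm : ∀ A : Set X, f ⁻¹' A ∈ U ↔ g ⁻¹' A ∈ U := by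
      intro A
      rw [← Ultrafilter.mem_map, ← Ultrafilter.mem_map, H]
    have hrange : g ⁻¹' (Set.range f) ∈ U := by
      rw [← hm, Set.preimage_range]
      exact Filter.univ_mem
    obtain ⟨x0, -⟩ := U.nonempty_of_mem hrange
    haveI : Nonempty X := ⟨x0⟩
    have hfix := aux_fix (fun x => Function.invFun f (g x)) U (by
      intro A
      have h1 : A ∈ U ↔ g ⁻¹' (f '' A) ∈ U := by
        rw [← hm, Set.preimage_image_eq A hf]
      rw [h1]
      constructor
      · intro h2
        filter_upwards [h2, hrange] with x hx hxr
        exact ⟨_, hx, Function.invFun_eq hxr⟩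
      · intro h2
        filter_upwards [h2] with x hx
        obtain ⟨a, ha, e⟩ := hx
        show Function.invFun f (g x) ∈ A
        rw [← e, Function.leftInverse_invFun hf]
        exact ha)
    filter_upwards [hfix, hrange] with x hx hxr
    have := Function.invFun_eq hxr
    change Function.invFun f (g x) = x at hx
    rw [hx] at this
    exact this
  · intro H
    apply Ultrafilter.coe_injective
    simp only [Ultrafilter.coe_map]
    exact Filter.map_congr H
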